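/- If a multihomogeneous polynomial with integer coefficients in the coordinates of m complex vector variables is invariant under the complex orthogonal group O(n,ℂ), then its reduction modulo 2 is invariant under O(n,k) for k an algebraically closed field of characteristic 2 (with the orthogonal groups defined by the standard quadratic forms). -/

import Mathlib

open MvPolynomial

/-- The standard quadratic form `x₁y₁ + ⋯ + x_ν y_ν (+ z²)` on `n`-space. -/
def stdQ (F : Type*) [CommRing F] (n : ℕ) (v : Fin n → F) : F :=
  (∑ r : Fin (n/2), v ⟨2*r.1, by have := r.2; omega⟩ * v ⟨2*r.1+1, by have := r.2; omega⟩)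
  + if h : n % 2 = 1 then (v ⟨n-1, by omega⟩)^2 else 0


/-- The action of a matrix `g` on polynomials in the coordinates of `m` vectors,
substituting `v ↦ g v` in each vector variable. -/
noncomputable def substAct {k : Type*} [CommSemiring k] {m n : ℕ}
    (g : Matrix (Fin n) (Fin n) k) :
    MvPolynomial (Fin m × Fin n) k →ₐ[k] MvPolynomial (Fin m × Fin n) k :=
  MvPolynomial.aeval fun ic => ∑ c : Fin n, MvPolynomial.C (g ic.2 c) * MvPolynomial.X (ic.1, c)


/-- Membership in the orthogonal group `O(n)`: an invertible matrix preserving `stdQ`. -/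
def inO {k : Type*} [CommRing k] {n : ℕ} (g : Matrix (Fin n) (Fin n) k) : Prop :=
  IsUnit g.det ∧ ∀ v : Fin n → k, stdQ k n (g.mulVec v) = stdQ k n v



section helpers

/-- The polar form of `stdQ`. -/
def qB (F : Type*) [CommRing F] (n : ℕ) (u v : Fin n → F) : F :=
  (∑ r : Fin (n/2), (u ⟨2*r.1, by have := r.2; omega⟩ * v ⟨2*r.1+1, by have := r.2; omega⟩
    + u ⟨2*r.1+1, by have := r.2; omega⟩ * v ⟨2*r.1, by have := r.2; omega⟩))
  + if h : n % 2 = 1 then 2 * (u ⟨n-1, by omega⟩ * v ⟨n-1, by omega⟩) else 0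

section ring
variable {F : Type*} [CommRing F] {n : ℕ}

theorem qB_symm (u v : Fin n → F) : qB F n u v = qB F n v u := by
  unfold qB
  congr 1
  · refine Finset.sum_congr rfl fun r _ => by ring
  · split_ifs
    · ring
    · rfl

theorem qB_add_left (u u' v : Fin n → F) : qB F n (u + u') v = qB F n u v + qB F n u' v := by
  unfold qB
  rw [add_add_add_comm, ← Finset.sum_add_distrib]
  congr 1
  · refine Finset.sum_congr rfl fun r _ => by simp only [Pi.add_apply]; ring
  · split_ifs
    · simp only [Pi.add_apply]; ring
    · simp

theorem qB_smul_left (c : F) (u v : Fin n → F) : qB F n (c • u) v = c * qB F n u v := by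
  unfold qB
  rw [mul_add, Finset.mul_sum]
  congr 1
  · refine Finset.sum_congr rfl fun r _ => by simp only [Pi.smul_apply, smul_eq_mul]; ring
  · split_ifs
    · simp only [Pi.smul_apply, smul_eq_mul]; ring
    · simp

theorem qB_sub_left (u u' v : Fin n → F) : qB F n (u - u') v = qB F n u v - qB F n u' v := by
  have : u - u' = u + (-1 : F) • u' := by simp [sub_eq_add_neg]
  rw [this, qB_add_left, qB_smul_left]; ring

theorem qB_add_right (u v v' : Fin n → F) : qB F n u (v + v') = qB F n u v + qB F n u v' := by
  rw [qB_symm, qB_add_left, qB_symm v, qB_symm v']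

theorem qB_sub_right (u v v' : Fin n → F) : qB F n u (v - v') = qB F n u v - qB F n u v' := by
  rw [qB_symm, qB_sub_left, qB_symm v, qB_symm v']

theorem qB_smul_right (c : F) (u v : Fin n → F) : qB F n u (c • v) = c * qB F n u v := by
  rw [qB_symm, qB_smul_left, qB_symm v]

theorem stdQ_add (u v : Fin n → F) :
    stdQ F n (u + v) = stdQ F n u + stdQ F n v + qB F n u v := by
  unfold qB stdQ
  have aux : ∀ a b c d e f : F, (a + b) + (c + d) + (e + f) = (a + c + e) + (b + d + f) := by
    intros; ring
  rw [aux, ← Finset.sum_add_distrib, ← Finset.sum_add_distrib]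
  congr 1
  · refine Finset.sum_congr rfl fun r _ => by simp only [Pi.add_apply]; ring
  · split_ifs
    · simp only [Pi.add_apply]; ring
    · simp

theorem stdQ_smul (c : F) (u : Fin n → F) : stdQ F n (c • u) = c ^ 2 * stdQ F n u := by
  unfold stdQ
  rw [mul_add, Finset.mul_sum]
  congr 1
  · refine Finset.sum_congr rfl fun r _ => by simp only [Pi.smul_apply, smul_eq_mul]; ring
  · split_ifs
    · simp only [Pi.smul_apply, smul_eq_mul]; ring
    · simp

theorem stdQ_sub (u v : Fin n → F) :
    stdQ F n (u - v) = stdQ F n u + stdQ F n v - qB F n u v := by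
  have : u - v = u + (-1 : F) • v := by simp [sub_eq_add_neg]
  rw [this, stdQ_add, stdQ_smul, qB_smul_right]; ring

theorem qB_self (u : Fin n → F) : qB F n u u = 2 * stdQ F n u := by
  have h := stdQ_add u u
  have h2 : u + u = (2 : F) • u := by rw [two_smul]
  rw [h2, stdQ_smul] at h
  linear_combination -h

theorem stdQ_map {G : Type*} [CommRing G] (φ : F →+* G) (u : Fin n → F) :
    φ (stdQ F n u) = stdQ G n (fun c => φ (u c)) := by
  unfold stdQ
  simp only [map_add, map_sum, map_mul]
  congr 1
  split_ifs <;> simp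

theorem qB_map {G : Type*} [CommRing G] (φ : F →+* G) (u v : Fin n → F) :
    φ (qB F n u v) = qB G n (fun c => φ (u c)) (fun c => φ (v c)) := by
  unfold qB
  simp only [map_add, map_sum, map_mul]
  congr 1
  split_ifs
  · simp only [map_mul, map_ofNat]
  · simp

/-- even basis vectors -/
def bE (F : Type*) [CommRing F] {n : ℕ} (r : Fin (n/2)) : Fin n → F :=
  Pi.single ⟨2*r.1, by have := r.2; omega⟩ 1
/-- odd basis vectors -/
def bF (F : Type*) [CommRing F] {n : ℕ} (r : Fin (n/2)) : Fin n → F :=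
  Pi.single ⟨2*r.1+1, by have := r.2; omega⟩ 1

theorem qB_bE (x : Fin n → F) (r : Fin (n/2)) :
    qB F n x (bE F r) = x ⟨2*r.1+1, by have := r.2; omega⟩ := by
  unfold qB bE
  rw [Finset.sum_eq_single r]
  · have hr := r.2
    rw [Pi.single_eq_same, Pi.single_eq_of_ne (by simp [Fin.ext_iff])]
    split_ifs with h
    · rw [Pi.single_eq_of_ne (by simp [Fin.ext_iff]; omega)]; ring
    · ring
  · intro s _ hs
    have : s.1 ≠ r.1 := fun h => hs (Fin.ext h)
    rw [Pi.single_eq_of_ne (by simp [Fin.ext_iff]; omega),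
      Pi.single_eq_of_ne (by simp [Fin.ext_iff]; omega)]; ring
  · simp

theorem qB_bF (x : Fin n → F) (r : Fin (n/2)) :
    qB F n x (bF F r) = x ⟨2*r.1, by have := r.2; omega⟩ := by
  unfold qB bF
  rw [Finset.sum_eq_single r]
  · have hr := r.2
    rw [Pi.single_eq_same, Pi.single_eq_of_ne (by simp [Fin.ext_iff])]
    split_ifs with h
    · rw [Pi.single_eq_of_ne (by simp [Fin.ext_iff]; omega)]; ring
    · ring
  · intro s _ hs
    have : s.1 ≠ r.1 := fun h => hs (Fin.ext h)
    rw [Pi.single_eq_of_ne (by simp [Fin.ext_iff]; omega),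
      Pi.single_eq_of_ne (by simp [Fin.ext_iff]; omega)]; ring
  · simp

theorem stdQ_bE (r : Fin (n/2)) : stdQ F n (bE F r) = 0 := by
  unfold stdQ bE
  rw [Finset.sum_eq_zero]
  · split_ifs with h
    · have hr := r.2
      rw [Pi.single_eq_of_ne (by simp [Fin.ext_iff]; omega)]; ring
    · ring
  · intro s _
    have hs := s.2
    have : (⟨2*s.1+1, by omega⟩ : Fin n) ≠ ⟨2*r.1, by have := r.2; omega⟩ := by
      simp [Fin.ext_iff]; omega
    rw [Pi.single_eq_of_ne this]; ring

theorem stdQ_bF (r : Fin (n/2)) : stdQ F n (bF F r) = 0 := by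
  unfold stdQ bF
  rw [Finset.sum_eq_zero]
  · split_ifs with h
    · have hr := r.2
      rw [Pi.single_eq_of_ne (by simp [Fin.ext_iff]; omega)]; ring
    · ring
  · intro s _
    have hs := s.2
    have : (⟨2*s.1, by omega⟩ : Fin n) ≠ ⟨2*r.1+1, by have := r.2; omega⟩ := by
      simp [Fin.ext_iff]; omega
    rw [Pi.single_eq_of_ne this]; ring

theorem qB_EE (r s : Fin (n/2)) : qB F n (bE F r) (bE F s) = 0 := by
  rw [qB_bE, bE, Pi.single_eq_of_ne (by simp [Fin.ext_iff]; omega)]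

theorem qB_FF (r s : Fin (n/2)) : qB F n (bF F r) (bF F s) = 0 := by
  rw [qB_bF, bF, Pi.single_eq_of_ne (by simp [Fin.ext_iff]; omega)]

theorem qB_EF (r s : Fin (n/2)) (h : r ≠ s) : qB F n (bE F r) (bF F s) = 0 := by
  have : r.1 ≠ s.1 := fun h' => h (Fin.ext h')
  rw [qB_bF, bE, Pi.single_eq_of_ne (by simp [Fin.ext_iff]; omega)]

theorem qB_FE (r s : Fin (n/2)) (h : r ≠ s) : qB F n (bF F r) (bE F s) = 0 := by
  rw [qB_symm, qB_EF _ _ h.symm]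

theorem qB_EF_self (r : Fin (n/2)) : qB F n (bE F r) (bF F r) = 1 := by
  rw [qB_bF, bE, Pi.single_eq_same]

theorem qB_FE_self (r : Fin (n/2)) : qB F n (bF F r) (bE F r) = 1 := by
  rw [qB_symm, qB_EF_self]

theorem stdQ_of_zero (x y : Fin n → F) (hE : ∀ r, qB F n x (bE F r) = qB F n y (bE F r))
    (hF : ∀ r, qB F n x (bF F r) = qB F n y (bF F r)) (hQ : stdQ F n x = stdQ F n y)
    (hsq : ∀ a b : F, a ^ 2 = b ^ 2 → a = b) : x = y := by
  simp only [qB_bE] at hE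
  simp only [qB_bF] at hF
  ext c
  by_cases hc : c.1 / 2 < n / 2
  · rcases Nat.even_or_odd' c.1 with ⟨t, ht | ht⟩
    · have := hF ⟨t, by omega⟩
      convert this using 2 <;> exact Fin.ext ht
    · have := hE ⟨t, by omega⟩
      convert this using 2 <;> exact Fin.ext ht
  · have hn : n % 2 = 1 := by have := c.2; omega
    have hcz : c = ⟨n-1, by omega⟩ := by ext; have := c.2; simp; omega
    apply hsq
    unfold stdQ at hQ
    simp only [hE, hF, hn, dif_pos] at hQ
    rw [hcz]
    exact add_left_cancel hQ

end ring

section field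
variable {k : Type*} [Field k] {n : ℕ}

/-- The reflection in `u`. -/
noncomputable def qRefl (u : Fin n → k) : (Fin n → k) →ₗ[k] (Fin n → k) where
  toFun v := v - (qB k n v u / stdQ k n u) • u
  map_add' v w := by
    rw [qB_add_left, add_div, add_smul]; abel
  map_smul' c v := by
    rw [qB_smul_left, mul_div_assoc, mul_smul, RingHom.id_apply, smul_sub]

theorem qRefl_apply (u v : Fin n → k) :
    qRefl u v = v - (qB k n v u / stdQ k n u) • u := rfl

theorem stdQ_qRefl (u v : Fin n → k) (hu : stdQ k n u ≠ 0) : stdQ k n (qRefl u v) = stdQ k n v := by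
  rw [qRefl_apply, stdQ_sub, stdQ_smul, qB_smul_right]
  field_simp
  ring

theorem qRefl_invol (u v : Fin n → k) (hu : stdQ k n u ≠ 0) : qRefl u (qRefl u v) = v := by
  have h : qB k n (qRefl u v) u = - qB k n v u := by
    rw [qRefl_apply, qB_sub_left, qB_smul_left, qB_self]; field_simp; ring
  rw [qRefl_apply u (qRefl u v), h, qRefl_apply, neg_div, neg_smul]
  simp

/-- Isometries. -/
def QIso (g : (Fin n → k) →ₗ[k] (Fin n → k)) : Prop := ∀ v, stdQ k n (g v) = stdQ k n v

theorem QIso.qB {g : (Fin n → k) →ₗ[k] (Fin n → k)} (h : QIso g) (u v : Fin n → k) :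
    qB k n (g u) (g v) = qB k n u v := by
  have h1 := h (u + v)
  rw [map_add, stdQ_add, stdQ_add, h, h] at h1
  exact add_left_cancel h1

theorem qRefl_fix (w y : Fin n → k) (h : qB k n w y = 0) : qRefl w y = y := by
  rw [qRefl_apply, qB_symm, h]; simp

theorem qRefl_move (a b : Fin n → k) (ha : stdQ k n a = 0) (hb : stdQ k n b = 0)
    (h : qB k n a b ≠ 0) : stdQ k n (a - b) ≠ 0 ∧ qRefl (a - b) a = b := by
  have h1 : stdQ k n (a - b) = - qB k n a b := by rw [stdQ_sub, ha, hb]; ring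
  have h2 : qB k n a (a - b) = - qB k n a b := by rw [qB_sub_right, qB_self, ha]; ring
  refine ⟨by rw [h1]; exact neg_ne_zero.2 h, ?_⟩
  rw [qRefl_apply, h1, h2, div_self (neg_ne_zero.2 h)]; simp

/-- One-reflection move. -/
theorem move_one {PInv : ((Fin n → k) →ₗ[k] (Fin n → k)) → Prop}
    (hcomp : ∀ u g, stdQ k n u ≠ 0 → PInv (qRefl u ∘ₗ g) → PInv g) (S : Set (Fin n → k)) (g : (Fin n → k) →ₗ[k] (Fin n → k)) (hg : QIso g)
    (hS : ∀ y ∈ S, g y = y) (x w : Fin n → k) (hx : stdQ k n x = 0) (hw : stdQ k n w = 0)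
    (hwS : ∀ y ∈ S, qB k n w y = qB k n x y) (h1 : qB k n (g x) w ≠ 0)
    (hnext : ∀ g' : (Fin n → k) →ₗ[k] (Fin n → k), QIso g' → (∀ y ∈ S, g' y = y) → g' x = w →
      PInv g') : PInv g := by
  obtain ⟨hq, hm⟩ := qRefl_move (g x) w (by rw [hg, hx]) hw h1
  apply hcomp _ g hq
  apply hnext
  · intro v; rw [LinearMap.comp_apply, stdQ_qRefl _ _ hq, hg]
  · intro y hy
    rw [LinearMap.comp_apply, hS y hy]
    apply qRefl_fix
    have := hg.qB x y
    rw [hS y hy] at this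
    rw [qB_sub_left, this, hwS y hy, sub_self]
  · exact hm

/-- Two-reflection move. -/
theorem move_two {PInv : ((Fin n → k) →ₗ[k] (Fin n → k)) → Prop}
    (hcomp : ∀ u g, stdQ k n u ≠ 0 → PInv (qRefl u ∘ₗ g) → PInv g) (S : Set (Fin n → k)) (g : (Fin n → k) →ₗ[k] (Fin n → k)) (hg : QIso g)
    (hS : ∀ y ∈ S, g y = y) (x w : Fin n → k) (hx : stdQ k n x = 0) (hw : stdQ k n w = 0)
    (hwS : ∀ y ∈ S, qB k n w y = qB k n x y) (h1 : qB k n (g x) w ≠ 0) (h2 : qB k n w x ≠ 0)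
    (hnext : ∀ g' : (Fin n → k) →ₗ[k] (Fin n → k), QIso g' → (∀ y ∈ S, g' y = y) → g' x = x →
      PInv g') : PInv g := by
  refine move_one hcomp S g hg hS x w hx hw hwS h1 fun g' hg' hS' hx' => ?_
  exact move_one hcomp S g' hg' hS' x x hx hx (fun _ _ => rfl) (by rwa [hx']) hnext

/-- The set of the first `j` hyperbolic pairs. -/
def pairs (k : Type*) [Field k] (n j : ℕ) : Set (Fin n → k) :=
  {y | ∃ r : Fin (n/2), r.1 < j ∧ (y = bE k r ∨ y = bF k r)}

theorem stepA {PInv : ((Fin n → k) →ₗ[k] (Fin n → k)) → Prop}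
    (hcomp : ∀ u g, stdQ k n u ≠ 0 → PInv (qRefl u ∘ₗ g) → PInv g) (j : Fin (n/2))
    (hnext : ∀ g : (Fin n → k) →ₗ[k] (Fin n → k), QIso g → (∀ y ∈ pairs k n j, g y = y) →
      g (bE k j) = bE k j → PInv g)
    (g : (Fin n → k) →ₗ[k] (Fin n → k)) (hg : QIso g) (hS : ∀ y ∈ pairs k n j, g y = y) :
    PInv g := by
  have oE : ∀ y ∈ pairs k n j, qB k n (bE k j) y = 0 := by
    rintro y ⟨r, hr, rfl | rfl⟩
    · exact qB_EE _ _
    · exact qB_EF _ _ (fun h => by rw [h] at hr; omega)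
  have oF : ∀ y ∈ pairs k n j, qB k n (bF k j) y = 0 := by
    rintro y ⟨r, hr, rfl | rfl⟩
    · exact qB_FE _ _ (fun h => by rw [h] at hr; omega)
    · exact qB_FF _ _
  have ogF : ∀ y ∈ pairs k n j, qB k n (g (bF k j)) y = 0 := by
    intro y hy
    have := hg.qB (bF k j) y
    rwa [hS y hy, oF y hy] at this
  have b1 : qB k n (g (bE k j)) (g (bF k j)) = 1 := by rw [hg.qB, qB_EF_self]
  by_cases h0 : qB k n (g (bE k j)) (bE k j) = 0
  swap
  · exact move_one hcomp _ g hg hS (bE k j) (bE k j) (stdQ_bE _) (stdQ_bE _) (fun _ _ => rfl) h0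
      hnext
  by_cases h1 : qB k n (g (bF k j)) (bE k j) = 0
  swap
  · refine move_two hcomp _ g hg hS (bE k j) (g (bF k j)) (stdQ_bE _) (by rw [hg, stdQ_bF])
      (fun y hy => by rw [ogF y hy, oE y hy]) (by rw [b1]; exact one_ne_zero) h1 hnext
  by_cases h2 : qB k n (g (bE k j)) (bF k j) = 0
  swap
  · refine move_two hcomp _ g hg hS (bE k j) (bF k j) (stdQ_bE _) (stdQ_bF _)
      (fun y hy => by rw [oF y hy, oE y hy]) h2 (by rw [qB_FE_self]; exact one_ne_zero) hnext
  refine move_two hcomp _ g hg hS (bE k j)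
    (bF k j + g (bF k j) - (qB k n (bF k j) (g (bF k j))) • bE k j) (stdQ_bE _) ?_ ?_ ?_ ?_ hnext
  · rw [stdQ_sub, stdQ_add, stdQ_smul, qB_smul_right, qB_add_left, hg, stdQ_bF, stdQ_bE, h1,
      qB_FE_self]; ring
  · intro y hy
    rw [qB_sub_left, qB_add_left, qB_smul_left, oF y hy, ogF y hy, oE y hy]; ring
  · rw [qB_sub_right, qB_add_right, qB_smul_right, h2, b1, h0]; simp
  · rw [qB_sub_left, qB_add_left, qB_smul_left, h1, qB_FE_self, qB_EE]; simp

theorem stepB {PInv : ((Fin n → k) →ₗ[k] (Fin n → k)) → Prop}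
    (hcomp : ∀ u g, stdQ k n u ≠ 0 → PInv (qRefl u ∘ₗ g) → PInv g) [Infinite k] (hsq : ∀ a b : k, a ^ 2 = b ^ 2 → a = b) (j : Fin (n/2))
    (hnext : ∀ g : (Fin n → k) →ₗ[k] (Fin n → k), QIso g → (∀ y ∈ pairs k n (j+1), g y = y) →
      PInv g)
    (g : (Fin n → k) →ₗ[k] (Fin n → k)) (hg : QIso g) (hS0 : ∀ y ∈ pairs k n j, g y = y)
    (hE : g (bE k j) = bE k j) :
    PInv g := by
  have hnext' : ∀ g : (Fin n → k) →ₗ[k] (Fin n → k), QIso g →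
      (∀ y ∈ insert (bE k j) (pairs k n j), g y = y) → g (bF k j) = bF k j → PInv g := by
    intro g hg h1 h2
    apply hnext g hg
    rintro y ⟨r, hr, hy⟩
    by_cases hrj : r = j
    · subst hrj
      rcases hy with rfl | rfl
      · exact h1 _ (Set.mem_insert _ _)
      · exact h2
    · have : r.1 ≠ j.1 := fun h => hrj (Fin.ext h)
      exact h1 _ (Set.mem_insert_of_mem _ ⟨r, by omega, hy⟩)
  have hS : ∀ y ∈ insert (bE k j) (pairs k n j), g y = y := by
    rintro y (rfl | hy)
    · exact hE
    · exact hS0 y hy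
  by_cases h0 : qB k n (g (bF k j)) (bF k j) = 0
  swap
  · exact move_one hcomp _ g hg hS (bF k j) (bF k j) (stdQ_bF _) (stdQ_bF _) (fun _ _ => rfl) h0
      hnext'
  obtain ⟨t, ht⟩ : ∃ t, t = g (bF k j) - bF k j := ⟨_, rfl⟩
  have hgt : g (bF k j) = bF k j + t := by rw [ht]; abel
  have tS : ∀ y ∈ insert (bE k j) (pairs k n j), qB k n t y = 0 := by
    intro y hy
    have := hg.qB (bF k j) y
    rw [hS y hy] at this
    rw [ht, qB_sub_left, this, sub_self]
  have tE : qB k n t (bE k j) = 0 := tS _ (Set.mem_insert _ _)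
  have tF : qB k n t (bF k j) = 0 := by rw [ht, qB_sub_left, h0, qB_FF, sub_zero]
  have tQ : stdQ k n t = 0 := by rw [ht, stdQ_sub, hg, stdQ_bF, h0]; ring
  by_cases hx : ∃ x : Fin n → k, stdQ k n x = 0 ∧ qB k n t x ≠ 0 ∧
      (∀ y ∈ insert (bE k j) (pairs k n j), qB k n x y = 0) ∧ qB k n x (bF k j) = 0
  · obtain ⟨x, hxQ, hxt, hxS, hxF⟩ := hx
    classical
    obtain ⟨a, ha⟩ := Infinite.exists_notMem_finset ({0, 1} : Finset k)
    simp only [Finset.mem_insert, Finset.mem_singleton, not_or] at ha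
    obtain ⟨ha0, ha1⟩ := ha
    have hxE : qB k n x (bE k j) = 0 := hxS _ (Set.mem_insert _ _)
    refine move_two hcomp _ g hg hS (bF k j)
      (bF k j + (a • t + x) - (a * qB k n t x) • bE k j) (stdQ_bF _) ?_ ?_ ?_ ?_ hnext'
    · rw [stdQ_sub, stdQ_add, stdQ_add, stdQ_smul, stdQ_smul, qB_smul_right]
      simp only [qB_add_left, qB_add_right, qB_smul_left, qB_smul_right]
      rw [stdQ_bF, stdQ_bE, tQ, hxQ, qB_FE_self, tE, hxE, qB_symm (bF k j) t, qB_symm (bF k j) x, tF, hxF]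
      ring
    · intro y hy
      rw [qB_sub_left, qB_add_left, qB_add_left, qB_smul_left, qB_smul_left, tS y hy, hxS y hy]
      have : qB k n (bE k j) y = 0 := by
        rcases hy with rfl | ⟨r, hr, rfl | rfl⟩
        · exact qB_EE _ _
        · exact qB_EE _ _
        · exact qB_EF _ _ (fun h => by rw [h] at hr; omega)
      rw [this]; ring
    · rw [hgt]
      simp only [qB_sub_right, qB_add_left, qB_add_right, qB_smul_left, qB_smul_right]
      rw [qB_FF, qB_self, tQ, qB_symm (bF k j) t, qB_symm (bF k j) x, tF, hxF, qB_FE_self, tE]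
      have : (1 - a) * qB k n t x ≠ 0 := mul_ne_zero (sub_ne_zero.2 (Ne.symm ha1)) hxt
      intro h; apply this; rw [← h]; ring
    · simp only [qB_sub_left, qB_add_left, qB_smul_left]
      rw [qB_FF, tF, hxF, qB_EF_self]
      have := mul_ne_zero ha0 hxt
      intro h; apply this; linear_combination -h
  · have key : ∀ r : Fin (n/2), qB k n t (bE k r) = 0 ∧ qB k n t (bF k r) = 0 := by
      intro r
      rcases lt_trichotomy r.1 j.1 with h | h | h
      · exact ⟨tS _ (Set.mem_insert_of_mem _ ⟨r, h, Or.inl rfl⟩),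
          tS _ (Set.mem_insert_of_mem _ ⟨r, h, Or.inr rfl⟩)⟩
      · rw [Fin.ext h]; exact ⟨tE, tF⟩
      · have hrj : r ≠ j := fun h' => by rw [h'] at h; omega
        constructor
        · by_contra hc
          refine hx ⟨bE k r, stdQ_bE _, hc, ?_, qB_EF _ _ hrj⟩
          rintro y (rfl | ⟨s, hs, rfl | rfl⟩)
          · exact qB_EE _ _
          · exact qB_EE _ _
          · exact qB_EF _ _ (fun h' => by rw [h'] at h; omega)
        · by_contra hc
          refine hx ⟨bF k r, stdQ_bF _, hc, ?_, qB_FF _ _⟩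
          rintro y (rfl | ⟨s, hs, rfl | rfl⟩)
          · exact qB_FE _ _ hrj
          · exact qB_FE _ _ (fun h' => by rw [h'] at h; omega)
          · exact qB_FF _ _
    have z : ∀ y : Fin n → k, qB k n 0 y = 0 := fun y => by
      have := qB_smul_left (0 : k) 0 y
      simpa using this
    have zQ : stdQ k n (0 : Fin n → k) = 0 := by
      have := stdQ_smul (0 : k) (0 : Fin n → k)
      simpa using this
    have ht0 : t = 0 := stdQ_of_zero t 0 (fun r => by rw [(key r).1, z])
      (fun r => by rw [(key r).2, z]) (by rw [tQ, zQ]) hsq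
    exact hnext' g hg hS (by rw [hgt, ht0, add_zero])

theorem all_inv {PInv : ((Fin n → k) →ₗ[k] (Fin n → k)) → Prop}
    (hcomp : ∀ u g, stdQ k n u ≠ 0 → PInv (qRefl u ∘ₗ g) → PInv g) [Infinite k] (hsq : ∀ a b : k, a ^ 2 = b ^ 2 → a = b)
    (hid : PInv LinearMap.id) (i : ℕ) : ∀ j, j + i = n / 2 →
    ∀ g : (Fin n → k) →ₗ[k] (Fin n → k), QIso g → (∀ y ∈ pairs k n j, g y = y) → PInv g := by
  induction i with
  | zero =>
    intro j hj g hg hS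
    have : g = LinearMap.id := by
      refine LinearMap.ext fun x => ?_
      refine stdQ_of_zero _ _ (fun r => ?_) (fun r => ?_) (hg x) hsq
      · have := hg.qB x (bE k r)
        rwa [hS _ ⟨r, by omega, Or.inl rfl⟩] at this
      · have := hg.qB x (bF k r)
        rwa [hS _ ⟨r, by omega, Or.inr rfl⟩] at this
    rw [this]; exact hid
  | succ i ih =>
    intro j hj g hg hS
    have hlt : j < n / 2 := by omega
    exact stepA hcomp ⟨j, hlt⟩ (stepB hcomp hsq ⟨j, hlt⟩ (ih (j+1) (by omega))) g hg hS

end field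

theorem eval_substAct {k : Type*} [CommRing k] {m n : ℕ} (g : Matrix (Fin n) (Fin n) k)
    (P : MvPolynomial (Fin m × Fin n) k) (v : Fin m × Fin n → k) :
    eval v (substAct g P) = eval (fun ic => g.mulVec (fun c => v (ic.1, c)) ic.2) P := by
  unfold substAct
  rw [aeval_def, ← coe_eval₂Hom, ← RingHom.comp_apply]
  have : (eval v).comp (eval₂Hom (algebraMap k (MvPolynomial (Fin m × Fin n) k))
      (fun ic : Fin m × Fin n => ∑ c : Fin n, C (g ic.2 c) * X (ic.1, c))) =
      eval (fun ic => g.mulVec (fun c => v (ic.1, c)) ic.2) := by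
    apply MvPolynomial.ringHom_ext
    · intro r; simp [algebraMap_eq]
    · intro i; simp [Matrix.mulVec, dotProduct]
  rw [this]

theorem hom_eval₂ {σ : Type*} {k : Type*} [CommRing k] (p : MvPolynomial σ ℤ) (D : ℕ)
    (hp : p.IsHomogeneous D) (c : k) (v : σ → k) :
    eval₂ (Int.castRingHom k) (fun i => c * v i) p =
      c ^ D * eval₂ (Int.castRingHom k) v p := by
  rw [eval₂_eq, eval₂_eq, Finset.mul_sum]
  refine Finset.sum_congr rfl fun d hd => ?_
  have h := hp (mem_support_iff.1 hd)
  simp only [mul_pow, Finset.prod_mul_distrib]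
  rw [Finset.prod_pow_eq_pow_sum]
  have : ∑ i ∈ d.support, d i = D := by
    rw [← h, Finsupp.weight_apply]; simp [Finsupp.sum]
  rw [this]; ring

/-- The generic cleared-denominator reflection identity, as a polynomial. -/
noncomputable def genG {m n : ℕ} (p : MvPolynomial (Fin m × Fin n) ℤ) (D : ℕ) :
    MvPolynomial ((Fin m × Fin n) ⊕ Fin n) ℤ :=
  (eval₂ (Int.castRingHom _) (fun ic => stdQ (MvPolynomial ((Fin m × Fin n) ⊕ Fin n) ℤ) n
      (fun c => X (Sum.inr c)) * X (Sum.inl ic) -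
      qB (MvPolynomial ((Fin m × Fin n) ⊕ Fin n) ℤ) n (fun c => X (Sum.inl (ic.1, c)))
        (fun c => X (Sum.inr c)) * X (Sum.inr ic.2)) p
      - stdQ (MvPolynomial ((Fin m × Fin n) ⊕ Fin n) ℤ) n (fun c => X (Sum.inr c)) ^ D *
        eval₂ (Int.castRingHom _) (fun ic => X (Sum.inl ic)) p) *
      stdQ (MvPolynomial ((Fin m × Fin n) ⊕ Fin n) ℤ) n (fun c => X (Sum.inr c))

theorem eval_genG {m n : ℕ} (p : MvPolynomial (Fin m × Fin n) ℤ) (D : ℕ)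
    {K : Type*} [Field K] (u : Fin n → K) (v : Fin m × Fin n → K) :
    eval₂Hom (Int.castRingHom K) (Sum.elim v u) (genG p D) =
      (eval₂ (Int.castRingHom K) (fun ic => stdQ K n u * v ic -
      qB K n (fun c => v (ic.1, c)) u * u ic.2) p
      - stdQ K n u ^ D * eval₂ (Int.castRingHom K) v p) * stdQ K n u := by
  have hφ : ∀ w : Fin m × Fin n → MvPolynomial ((Fin m × Fin n) ⊕ Fin n) ℤ,
      (eval₂Hom (Int.castRingHom K) (Sum.elim v u))
        (eval₂ (Int.castRingHom _) w p) = eval₂ (Int.castRingHom K)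
          (fun ic => (eval₂Hom (Int.castRingHom K) (Sum.elim v u)) (w ic)) p := by
    intro w
    rw [← coe_eval₂Hom, ← RingHom.comp_apply, ← coe_eval₂Hom]
    congr 1
    apply MvPolynomial.ringHom_ext
    · intro r; simp
    · intro r; simp
  simp only [genG, map_mul, map_sub, map_pow, hφ]
  simp only [stdQ_map (eval₂Hom (Int.castRingHom K) (Sum.elim v u)),
    qB_map (eval₂Hom (Int.castRingHom K) (Sum.elim v u)), eval₂Hom_X', Sum.elim_inl, Sum.elim_inr]

theorem eval_cleared {m n : ℕ} (p : MvPolynomial (Fin m × Fin n) ℤ) (D : ℕ)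
    (hp : p.IsHomogeneous D)
    {K : Type*} [Field K] (u : Fin n → K) (v : Fin m × Fin n → K) (hu : stdQ K n u ≠ 0) :
      eval₂ (Int.castRingHom K) (fun ic => stdQ K n u * v ic -
      qB K n (fun c => v (ic.1, c)) u * u ic.2) p =
      stdQ K n u ^ D * eval₂ (Int.castRingHom K)
        (fun ic => qRefl u (fun c => v (ic.1, c)) ic.2) p := by
  rw [← hom_eval₂ p D hp]
  congr 1
  funext ic
  rw [qRefl_apply]
  simp only [Pi.sub_apply, Pi.smul_apply, smul_eq_mul]
  field_simp

/-- The generic reflection invariance. -/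
theorem generic_refl {m n : ℕ} (p : MvPolynomial (Fin m × Fin n) ℤ) (D : ℕ)
    (hp : p.IsHomogeneous D)
    (hinv : ∀ g : Matrix (Fin n) (Fin n) ℂ, inO g →
      substAct g (MvPolynomial.map (Int.castRingHom ℂ) p) =
        MvPolynomial.map (Int.castRingHom ℂ) p)
    {k : Type*} [Field k] (u : Fin n → k) (hu : stdQ k n u ≠ 0) (v : Fin m × Fin n → k) :
    eval₂ (Int.castRingHom k) (fun ic => qRefl u (fun c => v (ic.1, c)) ic.2) p =
      eval₂ (Int.castRingHom k) v p := by
  -- complex case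
  have hC : ∀ (u : Fin n → ℂ) (_ : stdQ ℂ n u ≠ 0) (v : Fin m × Fin n → ℂ),
      eval₂ (Int.castRingHom ℂ) (fun ic => qRefl u (fun c => v (ic.1, c)) ic.2) p =
      eval₂ (Int.castRingHom ℂ) v p := by
    intro u hu v
    have hmv : ∀ x, (LinearMap.toMatrix' (qRefl u)).mulVec x = qRefl u x := fun x => by
      rw [← Matrix.toLin'_apply, Matrix.toLin'_toMatrix']
    have hO : inO (LinearMap.toMatrix' (qRefl u)) := by
      constructor
      · have : LinearMap.toMatrix' (qRefl u) * LinearMap.toMatrix' (qRefl u) = 1 := by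
          rw [← LinearMap.toMatrix'_comp, ← LinearMap.toMatrix'_id]
          congr 1
          exact LinearMap.ext fun x => qRefl_invol u x hu
        have h2 := congrArg Matrix.det this
        rw [Matrix.det_mul, Matrix.det_one] at h2
        exact IsUnit.of_mul_eq_one _ h2
      · intro x; rw [hmv, stdQ_qRefl _ _ hu]
    have := congrArg (eval v) (hinv _ hO)
    rw [eval_substAct] at this
    simp only [hmv] at this
    rwa [eval_map, eval_map] at this
  have hG : genG p D = 0 := by
    apply MvPolynomial.map_injective (Int.castRingHom ℂ) Int.cast_injective
    rw [map_zero]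
    apply MvPolynomial.funext
    intro x
    rw [eval_map, map_zero, ← coe_eval₂Hom, ← Sum.elim_comp_inl_inr x, eval_genG]
    by_cases h : stdQ ℂ n (x ∘ Sum.inr) = 0
    · rw [h, mul_zero]
    · rw [eval_cleared p D hp _ _ h, hC _ h, sub_self, zero_mul]
  have h := eval_genG p D u v
  rw [hG, map_zero, eval_cleared p D hp _ _ hu, ← mul_sub] at h
  have h2 := (mul_eq_zero.1 h.symm).resolve_right hu
  exact sub_eq_zero.1 ((mul_eq_zero.1 h2).resolve_left (pow_ne_zero _ hu))

end helpers

/-- If a multihomogeneous polynomial with integer coefficients in the coordinates of `m`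
vector variables in `n`-space is invariant under the complex orthogonal group `O(n,ℂ)`,
then its reduction modulo 2 (viewed in any algebraically closed field `k` of
characteristic 2) is invariant under `O(n,k)`. -/
theorem mod_two_reduction_invariant
    {m n : ℕ} (p : MvPolynomial (Fin m × Fin n) ℤ)
    (hhom : ∃ d : Fin m → ℕ, ∀ mon ∈ p.support, ∀ i : Fin m, (∑ c : Fin n, mon (i, c)) = d i)
    (hinv : ∀ g : Matrix (Fin n) (Fin n) ℂ, inO g →
      substAct g (MvPolynomial.map (Int.castRingHom ℂ) p) =
        MvPolynomial.map (Int.castRingHom ℂ) p)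
    (k : Type*) [Field k] [IsAlgClosed k] [CharP k 2] :
    ∀ g : Matrix (Fin n) (Fin n) k, inO g →
      substAct g (MvPolynomial.map (Int.castRingHom k) p) =
        MvPolynomial.map (Int.castRingHom k) p := by
  obtain ⟨d, hd⟩ := hhom
  have hp : p.IsHomogeneous (∑ i, d i) := by
    intro mon hmon
    have h := hd mon (mem_support_iff.2 hmon)
    rw [← Finset.sum_congr rfl (fun i _ => h i), ← Fintype.sum_prod_type', Finsupp.weight_apply,
      Finsupp.sum_fintype _ _ (by simp)]
    simp
  have : Infinite k := IsAlgClosed.instInfinite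
  have hsq : ∀ a b : k, a ^ 2 = b ^ 2 → a = b := by
    intro a b h
    have h2 : (a - b) ^ 2 = 0 := by
      have h3 : (2 : k) = 0 := CharTwo.two_eq_zero
      linear_combination h + (b ^ 2 - a * b) * h3
    exact sub_eq_zero.1 (pow_eq_zero_iff (two_ne_zero) |>.1 h2)
  intro g hg
  apply MvPolynomial.funext
  intro v
  rw [eval_substAct, eval_map, eval_map]
  have key := all_inv (k := k) (n := n)
    (PInv := fun h => ∀ v : Fin m × Fin n → k,
      eval₂ (Int.castRingHom k) (fun ic => h (fun c => v (ic.1, c)) ic.2) p =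
      eval₂ (Int.castRingHom k) v p) ?_ hsq ?_ (n/2) 0 (by omega) (Matrix.toLin' g) ?_ ?_
  · simpa only [Matrix.toLin'_apply] using key v
  · intro u h hu hh v
    rw [← hh v]
    have := generic_refl p _ hp hinv u hu (fun ic => h (fun c => v (ic.1, c)) ic.2)
    rw [← this]
    rfl
  · intro v; rfl
  · intro x; rw [Matrix.toLin'_apply, hg.2]
  · rintro y ⟨r, hr, _⟩
    omega
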